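/- arXiv:1701.06163 — 2 statements merged into one kernel-verified Lean document; each statement's English description precedes it below -/
import Mathlib

section
/- Let H₁, H₂ be complex Hilbert spaces and T a closed densely defined linear operator from H₁ to H₂. Then D(T*T) = {x ∈ D(T) : Tx ∈ D(T*)} is a core for T: the closure of the restriction of T to D(T*T) equals T. -/
/-- An injective bounded operator between Hilbert spaces has an adjoint with dense range. -/
theorem ContinuousLinearMap.denseRange_adjoint_of_injective
    {𝕜 E F : Type*} [RCLike 𝕜]
    [NormedAddCommGroup E] [InnerProductSpace 𝕜 E] [CompleteSpace E]
    [NormedAddCommGroup F] [InnerProductSpace 𝕜 F] [CompleteSpace F]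
    (A : E →L[𝕜] F) (hA : Function.Injective A) : DenseRange A.adjoint := by
  have h : A.adjoint.rangeᗮ = ⊥ := by
    rw [ContinuousLinearMap.orthogonal_range, ContinuousLinearMap.adjoint_adjoint]
    exact LinearMap.ker_eq_bot.mpr hA
  exact Submodule.dense_iff_topologicalClosure_eq_top.mpr
    (Submodule.topologicalClosure_eq_top_iff.mpr h)

/-- For a closed densely defined operator `T` between Hilbert spaces,
`D(T*T) = {x ∈ D(T) : Tx ∈ D(T*)}` is a core for `T`: the closure of the graph of the
restriction of `T` to `D(T*T)` is the graph of `T`. -/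
theorem stmt15
    {H₁ H₂ : Type*}
    [NormedAddCommGroup H₁] [InnerProductSpace ℂ H₁] [CompleteSpace H₁]
    [NormedAddCommGroup H₂] [InnerProductSpace ℂ H₂] [CompleteSpace H₂]
    (T : H₁ →ₗ.[ℂ] H₂) (hd : Dense (T.domain : Set H₁)) (hc : T.IsClosed) :
    closure {q : H₁ × H₂ | ∃ hx : q.1 ∈ T.domain,
        T ⟨q.1, hx⟩ ∈ T.adjoint.domain ∧ q.2 = T ⟨q.1, hx⟩} =
      (T.graph : Set (H₁ × H₂)) := by
  apply subset_antisymm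
  · refine closure_minimal ?_ hc
    rintro ⟨x, y⟩ ⟨hx, -, hy⟩
    exact (LinearPMap.mem_graph_iff T).mpr ⟨⟨x, hx⟩, rfl, hy.symm⟩
  let G : Submodule ℂ (WithLp 2 (H₁ × H₂)) :=
    T.graph.comap (WithLp.linearEquiv 2 ℂ (H₁ × H₂)).toLinearMap
  have hG : IsClosed (G : Set (WithLp 2 (H₁ × H₂))) :=
    IsClosed.preimage (WithLp.prod_continuous_ofLp 2 H₁ H₂) hc
  have : CompleteSpace G := hG.completeSpace_coe
  let P : G →L[ℂ] H₁ := (WithLp.fstL 2 ℂ H₁ H₂).comp G.subtypeL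
  have hP : Function.Injective P := by
    rw [injective_iff_map_eq_zero]
    rintro ⟨z, hz⟩ h
    have h1 : z.fst = 0 := h
    have h2 : z.snd = 0 := LinearPMap.graph_fst_eq_zero_snd T hz h1
    exact Subtype.ext (WithLp.ofLp_injective 2 (Prod.ext h1 h2))
  intro q hq
  refine map_mem_closure
    (f := fun z : G => WithLp.ofLp (z : WithLp 2 (H₁ × H₂)))
    ((WithLp.prod_continuous_ofLp 2 H₁ H₂).comp continuous_subtype_val)
    (P.denseRange_adjoint_of_injective hP ⟨WithLp.toLp 2 q, hq⟩) ?_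
  rintro _ ⟨h, rfl⟩
  obtain ⟨x, hx₁, hx₂⟩ := (LinearPMap.mem_graph_iff T).mp (P.adjoint h).2
  have hx : (WithLp.ofLp (P.adjoint h : WithLp 2 (H₁ × H₂))).1 ∈ T.domain := hx₁ ▸ x.2
  have hxx : (⟨_, hx⟩ : T.domain) = x := Subtype.ext hx₁.symm
  refine ⟨hx, ?_, ?_⟩
  · rw [hxx]
    refine LinearPMap.mem_adjoint_domain_of_exists _ ⟨h - x, fun y => ?_⟩
    have key := P.adjoint_inner_left ⟨WithLp.toLp 2 ((y : H₁), T y), T.mem_graph y⟩ h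
    rw [Submodule.coe_inner, WithLp.prod_inner_apply] at key
    have e₁ : (P.adjoint h : WithLp 2 (H₁ × H₂)).ofLp.1 = x := hx₁.symm
    have e₂ : (P.adjoint h : WithLp 2 (H₁ × H₂)).ofLp.2 = T x := hx₂.symm
    rw [e₁, e₂] at key
    rw [inner_sub_left, sub_eq_iff_eq_add']
    exact key.symm
  · rw [hxx]
    exact hx₂.symm
end

section
/- Let ℘ be a probability measure on (Ω,𝒜) and H a complex separable Hilbert space. For every bounded linear operator A : H → L²(℘,H) there exists a sequence (A_n) of bounded linear operators A_n : H → L²(℘,H), each decomposable by a measurable family of bounded operators on H (i.e. for each n there is a_n : Ω → B(H) with ω ↦ a_n(ω)x strongly measurable and (A_n x)(ω) = a_n(ω)x a.e. for every x ∈ H), such that A_n x → A x in L²(℘,H) for every x ∈ H. In other words, the decomposable second-order Skorohod operators are dense in B(H, L²(℘,H)) in the topology of pointwise (strong) convergence of operators. -/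
open MeasureTheory Filter

/-- The span of the first `n` terms of a sequence is finite-dimensional and grows with `n`; for a
dense sequence these spans exhaust the whole space up to closure. -/
theorem exists_monotone_finiteDimensional_dense (𝕜 E : Type*) [NormedField 𝕜]
    [SeminormedAddCommGroup E] [NormedSpace 𝕜 E] [TopologicalSpace.SeparableSpace E] :
    ∃ U : ℕ → Submodule 𝕜 E, Monotone U ∧ (∀ n, FiniteDimensional 𝕜 (U n)) ∧
      ⊤ ≤ (⨆ n, U n).topologicalClosure := by
  let d := TopologicalSpace.denseSeq E
  refine ⟨fun n => Submodule.span 𝕜 (d '' Set.Iio n), fun m n hmn => ?_, fun n => ?_, ?_⟩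
  · exact Submodule.span_mono (Set.image_mono (Set.Iio_subset_Iio hmn))
  · exact FiniteDimensional.span_of_finite 𝕜 ((Set.finite_Iio n).image d)
  · intro x _
    refine closure_mono ?_ (TopologicalSpace.denseRange_denseSeq E x)
    rintro _ ⟨i, rfl⟩
    exact Submodule.mem_iSup_of_mem (i + 1)
      (Submodule.subset_span ⟨i, Set.mem_Iio.2 i.lt_succ_self, rfl⟩)

/-- A bounded operator into `Lp` precomposed with a finite-rank orthogonal projection is
decomposable by a strongly measurable family of bounded operators. -/
theorem exists_decomposition_comp_starProjection {𝕜 Ω E F : Type*} [RCLike 𝕜]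
    [MeasurableSpace Ω] {μ : Measure Ω} {p : ENNReal} [Fact (1 ≤ p)]
    [NormedAddCommGroup E] [InnerProductSpace 𝕜 E] [NormedAddCommGroup F] [NormedSpace 𝕜 F]
    (A : E →L[𝕜] Lp F p μ) (U : Submodule 𝕜 E) [FiniteDimensional 𝕜 U] :
    ∃ a : Ω → (E →L[𝕜] F), (∀ x, StronglyMeasurable fun ω => a ω x) ∧
      ∀ x, ⇑((A ∘L U.starProjection) x) =ᵐ[μ] fun ω => a ω x := by
  let b := stdOrthonormalBasis 𝕜 U
  refine ⟨fun ω => ∑ i, (innerSL 𝕜 (b i : E)).smulRight (A (b i) ω), fun x => ?_, fun x => ?_⟩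
  · simp only [sum_apply, ContinuousLinearMap.smulRight_apply]
    exact Finset.stronglyMeasurable_fun_sum _ fun i _ =>
      (Lp.stronglyMeasurable (A (b i))).const_smul _
  · have hx : (A ∘L U.starProjection) x = ∑ i, inner 𝕜 (b i : E) x • A (b i) := by
      simp [b.starProjection_eq_sum_rankOne]
    have hsmul : ∀ᵐ ω ∂μ, ∀ i, (inner 𝕜 (b i : E) x • A (b i)) ω =
        inner 𝕜 (b i : E) x • A (b i) ω :=
      ae_all_iff.2 fun i => Lp.coeFn_smul _ _
    rw [hx]
    filter_upwards [Lp.coeFn_fun_finsetSum Finset.univ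
      fun i => inner 𝕜 (b i : E) x • A (b i), hsmul] with ω hsum hω
    rw [hsum]
    simp only [hω, sum_apply, ContinuousLinearMap.smulRight_apply, innerSL_apply_apply]

/-- The decomposable second-order Skorohod operators are dense in
`B(H, L²(℘,H))` in the topology of pointwise (strong) convergence: every bounded
operator `A : H → L²(℘,H)` is the pointwise limit of a sequence of bounded operators,
each decomposable by a measurable family of bounded operators on `H`. -/
theorem stmt19
    {Ω : Type*} [MeasurableSpace Ω] (℘ : Measure Ω) [IsProbabilityMeasure ℘]
    {H : Type*}
    [NormedAddCommGroup H] [InnerProductSpace ℂ H] [CompleteSpace H]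
    [SecondCountableTopology H]
    (A : H →L[ℂ] Lp H 2 ℘) :
    ∃ (a : ℕ → Ω → (H →L[ℂ] H)) (B : ℕ → (H →L[ℂ] Lp H 2 ℘)),
      (∀ (n : ℕ) (x : H), StronglyMeasurable fun ω => a n ω x) ∧
      (∀ (n : ℕ) (x : H), ⇑(B n x) =ᵐ[℘] fun ω => a n ω x) ∧
      (∀ x : H, Tendsto (fun n => B n x) atTop (nhds (A x))) := by
  obtain ⟨U, hU, hfin, hdense⟩ := exists_monotone_finiteDimensional_dense ℂ H
  choose a ha hAa using fun n => exists_decomposition_comp_starProjection A (U n)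
  exact ⟨a, fun n => A ∘L (U n).starProjection, ha, hAa, fun x =>
    (A.continuous.tendsto x).comp (Submodule.starProjection_tendsto_self U hU x hdense)⟩
end
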